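/- Among the vectors K ∈ L'⊗ℚ such that (i) (⟨K,R_0⟩, ⟨K,R_1⟩, ⟨K,R_2⟩, ⟨K,R_3⟩) is one of the five tuples (5,0,0,0), (−1,−2,0,0), (3,0,0,−2), (−5,0,0,0), (1,0,−2,0), and (ii) for each i = 1,…,9, ⟨K,S_i⟩ is an integer with |⟨K,S_i⟩| ≤ −⟨S_i,S_i⟩ and ⟨K,S_i⟩ ≡ ⟨S_i,S_i⟩ (mod 2), exactly 17496 lie in L' = ℤ^13 and are characteristic for ⟨,⟩ (i.e. ⟨K,x⟩ ≡ ⟨x,x⟩ (mod 2) for all x ∈ L'); and among those 17496, exactly 3754 satisfy ⟨K,K⟩ ≥ −3. -/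

import Mathlib

/-!  The lattice `L' = ℤ¹³` with the intersection form of `(S²×S²) # 11 ℂP²bar`,
coordinates with respect to the basis `A, B, E₁, …, E₁₁`, and the vectors from
Ozsváth–Szabó's analysis of Park's manifold `Q`. -/

namespace ParkQ

abbrev L' : Type := Fin 13 → ℤ
abbrev LQ' : Type := Fin 13 → ℚ

/-- The intersection form: `⟨A,B⟩ = 1`, `⟨A,A⟩ = ⟨B,B⟩ = 0`, `⟨Eᵢ,Eⱼ⟩ = -δᵢⱼ`,
`⟨A,Eᵢ⟩ = ⟨B,Eᵢ⟩ = 0`. -/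
def form (x y : L') : ℤ :=
  x 0 * y 1 + x 1 * y 0 - ∑ i : Fin 13, if 2 ≤ (i : ℕ) then x i * y i else 0

/-- The same form, extended `ℚ`-bilinearly to `L' ⊗ ℚ = ℚ¹³`. -/
def formQ (x y : LQ') : ℚ :=
  x 0 * y 1 + x 1 * y 0 - ∑ i : Fin 13, if 2 ≤ (i : ℕ) then x i * y i else 0

/-- The natural inclusion `L' → L' ⊗ ℚ`. -/
def toQ (x : L') : LQ' := fun i => (x i : ℚ)

def A : L' := ![1,0,0,0,0,0,0,0,0,0,0,0,0]
def B : L' := ![0,1,0,0,0,0,0,0,0,0,0,0,0]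

/-- `R₀ = 7A+6B−4E₁−3E₂−3E₃−3E₄−3E₅−3E₆−2E₇−3E₈−3E₉−2E₁₀−2E₁₁` -/
def R0 : L' := ![7,6,-4,-3,-3,-3,-3,-3,-2,-3,-3,-2,-2]
/-- `R₁ = E₄−E₇` -/
def R1 : L' := ![0,0,0,0,0,1,0,0,-1,0,0,0,0]
/-- `R₂ = B−E₁−E₄` -/
def R2 : L' := ![0,1,-1,0,0,-1,0,0,0,0,0,0,0]
/-- `R₃ = A−E₂−E₃` -/
def R3 : L' := ![1,0,0,-1,-1,0,0,0,0,0,0,0,0]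

def R : Fin 4 → L' := ![R0, R1, R2, R3]

/-- `S₁ = E₁₀−E₁₁` -/
def S1 : L' := ![0,0,0,0,0,0,0,0,0,0,0,1,-1]
/-- `S₂ = E₅−E₆` -/
def S2 : L' := ![0,0,0,0,0,0,1,-1,0,0,0,0,0]
/-- `S₃ = E₈−E₉` -/
def S3 : L' := ![0,0,0,0,0,0,0,0,0,1,-1,0,0]
/-- `S₄ = E₅−E₈` -/
def S4 : L' := ![0,0,0,0,0,0,1,0,0,-1,0,0,0]
/-- `S₅ = E₂−E₃` -/
def S5 : L' := ![0,0,0,1,-1,0,0,0,0,0,0,0,0]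
/-- `S₆ = A−E₁−E₁₀` -/
def S6 : L' := ![1,0,-1,0,0,0,0,0,0,0,0,-1,0]
/-- `S₇ = A+B−E₁−E₂−E₅−E₈` -/
def S7 : L' := ![1,1,-1,-1,0,0,-1,0,0,-1,0,0,0]
/-- `S₈ = 2A−2E₄−2E₇−E₁₁` -/
def S8 : L' := ![2,0,0,0,0,-2,0,0,-2,0,0,0,-1]
/-- `S₉ = 2A+2B−E₁−E₂−E₃−E₄−E₇−2E₅−E₆−E₁₀` -/
def S9 : L' := ![2,2,-1,-1,-1,-1,-2,-1,-1,0,0,-1,0]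

def S : Fin 9 → L' := ![S1, S2, S3, S4, S5, S6, S7, S8, S9]

/-- The period point `H ∈ L' ⊗ ℚ`. -/
def H : LQ' := ![229,226,-143,-113,-113,-86,-87,-87,-86,-87,-87,-58,-58]

/-- The canonical class `K_Q = −2A−2B+E₁+⋯+E₁₁`. -/
def KQ : L' := ![-2,-2,1,1,1,1,1,1,1,1,1,1,1]

/-- `K` is characteristic: `⟨K,x⟩ ≡ ⟨x,x⟩ (mod 2)` for all `x ∈ L'`. -/
def IsCharacteristic (K : L') : Prop := ∀ x : L', form K x ≡ form x x [ZMOD 2]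

/-- The set of `{Sᵢ}`-adjunctive vectors in `L' ⊗ ℚ` whose pairings with the blow-down
configuration `{Rᵢ}` take one of the five allowed forms. -/
def AdjQ : Set LQ' :=
  {K | (formQ K (toQ R0), formQ K (toQ R1), formQ K (toQ R2), formQ K (toQ R3)) ∈
      ({(5,0,0,0), (-1,-2,0,0), (3,0,0,-2), (-5,0,0,0), (1,0,-2,0)} :
        Set (ℚ × ℚ × ℚ × ℚ)) ∧
    ∀ i : Fin 9, ∃ m : ℤ, formQ K (toQ (S i)) = (m : ℚ) ∧
      |m| ≤ -form (S i) (S i) ∧ m ≡ form (S i) (S i) [ZMOD 2]}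

/-- Those adjunctive vectors which are integral and characteristic. -/
def CharAdj : Set LQ' := {K ∈ AdjQ | ∃ K' : L', toQ K' = K ∧ IsCharacteristic K'}

/-- The form written out in coordinates. -/
theorem form_eq (x y : L') : form x y = x 0 * y 1 + x 1 * y 0 -
    (x 2 * y 2 + x 3 * y 3 + x 4 * y 4 + x 5 * y 5 + x 6 * y 6 + x 7 * y 7 + x 8 * y 8 +
      x 9 * y 9 + x 10 * y 10 + x 11 * y 11 + x 12 * y 12) := by
  simp only [form, Fin.sum_univ_succ, Fin.sum_univ_zero]
  simp
  ring_nf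

theorem formQ_toQ (x y : L') : formQ (toQ x) (toQ y) = (form x y : ℚ) := by
  simp [formQ, form, toQ]

theorem toQ_injective : Function.Injective toQ := fun x y h => by
  funext i
  have := congrFun h i
  simpa [toQ] using this

/-- Even coordinates along `A`, `B` and odd ones along each `Eᵢ` make a vector characteristic. -/
theorem isCharacteristic_of_parity {K : L'} (h0 : Even (K 0)) (h1 : Even (K 1))
    (h : ∀ i : Fin 13, 2 ≤ (i : ℕ) → Odd (K i)) : IsCharacteristic K := by
  intro x
  have hE (i : Fin 13) (hi : 2 ≤ (i : ℕ)) : Even (x i * x i - K i * x i) := by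
    have := h i hi
    rw [← sub_mul, Int.even_mul]
    by_cases hx : Even (x i)
    · exact Or.inr hx
    · exact Or.inl ((Int.not_even_iff_odd.mp hx).sub_odd this)
  refine (Int.modEq_iff_dvd.mpr (even_iff_two_dvd.mp ?_))
  have key : form x x - form K x = (x 0 * x 1 + x 0 * x 1) - K 0 * x 1 - K 1 * x 0 -
      ∑ i : Fin 13, (if 2 ≤ (i : ℕ) then x i * x i - K i * x i else 0) := by
    have : ∑ i : Fin 13, (if 2 ≤ (i : ℕ) then x i * x i - K i * x i else 0) =
        (∑ i : Fin 13, if 2 ≤ (i : ℕ) then x i * x i else 0) -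
          ∑ i : Fin 13, if 2 ≤ (i : ℕ) then K i * x i else 0 := by
      rw [← Finset.sum_sub_distrib]
      exact Finset.sum_congr rfl fun i _ => by split_ifs <;> simp
    rw [this]
    simp only [form]
    ring
  rw [key]
  refine (((Even.add_self _).sub (h0.mul_right _)).sub (h1.mul_right _)).sub ?_
  refine Finset.even_sum _ fun i _ => ?_
  split_ifs with hi
  · exact hE i hi
  · exact Even.zero

/-- Half-integral coordinates for the pairings: `(r₀, r₁, r₂, r₃)` stands for the pairings
`2r₀-5, 2r₁-2, 2r₂-2, 2r₃-2` with the `Rᵢ`, and `(x₁, …, x₇, x₉)` for the pairings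
`2xᵢ-2` with `S₁, …, S₇` and `2x₉-3` with `S₉`. -/
abbrev Param : Type := (ℕ × ℕ × ℕ × ℕ) × ℕ × ℕ × ℕ × ℕ × ℕ × ℕ × ℕ × ℕ

/-- The five allowed quadruples of pairings with the `Rᵢ`. -/
def types : Finset (ℕ × ℕ × ℕ × ℕ) :=
  {(5, 1, 1, 1), (2, 0, 1, 1), (4, 1, 1, 0), (0, 1, 1, 1), (3, 1, 0, 1)}

/-- The parameters allowed by all conditions but the one on `S₈`. -/
def box : Finset Param :=
  types ×ˢ Finset.range 3 ×ˢ Finset.range 3 ×ˢ Finset.range 3 ×ˢ Finset.range 3 ×ˢ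
    Finset.range 3 ×ˢ Finset.range 3 ×ˢ Finset.range 3 ×ˢ Finset.range 4

/-- The linear form governing integrality, see `level`. -/
def levelAt (r0 r1 r2 r3 x1 x2 x3 x4 x5 x6 x7 x9 : ℕ) : ℕ :=
  8 + 19 * r0 + 8 * r1 + 22 * r2 + 11 * r3 + 13 * x1 + 12 * x2 + 18 * x3 + 9 * x4 + x5 + 19 * x6 +
    2 * x7 + 6 * x9

/-- Integrality forces the pairing with `S₈` to be `2b-9` with `b ≡ level p` modulo `25`. -/
def level : Param → ℕ
  | ((r0, r1, r2, r3), x1, x2, x3, x4, x5, x6, x7, x9) =>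
    levelAt r0 r1 r2 r3 x1 x2 x3 x4 x5 x6 x7 x9

/-- The half-coordinates `(a, b, e₁, e₂, e₄, e₅, e₁₀)` of the vector with pairings `p`:
its coordinates along `A, B` are `2a, 2b` and those along `Eᵢ` are `2eᵢ+1`. -/
def core (p : Param) : ℤ × ℤ × ℤ × ℤ × ℤ × ℤ × ℤ :=
  match p with
  | ((r0, r1, r2, r3), x1, x2, x3, x4, x5, x6, x7, x9) =>
    let q : ℤ := (level p / 25 : ℕ)
    (9 * q + (3 * x4 + 2 * x9 : ℕ) -
        (8 * r0 + 4 * r1 + 9 * r2 + 5 * r3 + 2 * x1 + 5 * x2 + 3 * x3 + 6 * x6 + 15 : ℕ),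
      (2 * r0 + 2 * r2 + r3 + 4 * x1 + 2 * x2 + 6 * x3 + 6 * x4 + x5 + 4 * x6 + 2 * x7 +
        4 * x9 : ℕ) - 4 * q - 11,
      (3 * r0 + 2 * r1 + 4 * r2 + 2 * r3 + 2 * x2 + 2 * x6 + 7 : ℕ) - 3 * q -
        (3 * x4 + 2 * x9 : ℕ),
      2 * q + 5 - (r0 + r2 + 2 * x1 + x2 + 3 * x3 + 3 * x4 + x5 + 2 * x6 + x7 + 2 * x9 : ℕ),
      (5 * r0 + 2 * r1 + 6 * r2 + 3 * r3 + 2 * x1 + 3 * x2 + 3 * x3 + 4 * x6 + 6 : ℕ) - 6 * q,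
      (2 * r0 + r1 + 2 * r2 + r3 + x2 + x6 + 6 : ℕ) - 2 * q - (2 * x4 + x9 : ℕ),
      7 * q + 2 - (5 * r0 + 2 * r1 + 6 * r2 + 3 * r3 + 4 * x1 + 4 * x2 + 6 * x3 + 3 * x4 + x5 +
        5 * x6 + 2 * x7 + 2 * x9 : ℕ))

/-- The vector with pairings `p`. -/
def vec (p : Param) : L' :=
  match p, core p with
  | ((_, r1, _, _), x1, x2, x3, x4, x5, _, _, _), (a, b, e1, e2, e4, e5, e10) =>
    ![2 * a, 2 * b, 2 * e1 + 1, 2 * e2 + 1, 2 * (e2 + x5 - 1) + 1, 2 * e4 + 1, 2 * e5 + 1,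
      2 * (e5 + x2 - 1) + 1, 2 * (e4 + r1 - 1) + 1, 2 * (e5 + x4 - 1) + 1,
      2 * (e5 + x4 + x3 - 2) + 1, 2 * e10 + 1, 2 * (e10 + x1 - 1) + 1]

/-- The parameters satisfying the condition on `S₈`. -/
def params : Finset Param := box.filter fun p => level p % 25 < 10

theorem vec_pairings (r0 r1 r2 r3 x1 x2 x3 x4 x5 x6 x7 x9 : ℕ) :
    let p : Param := ((r0, r1, r2, r3), x1, x2, x3, x4, x5, x6, x7, x9)
    let K := vec p
    form K R0 = 2 * r0 - 5 ∧ form K R1 = 2 * r1 - 2 ∧ form K R2 = 2 * r2 - 2 ∧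
    form K R3 = 2 * r3 - 2 ∧ form K S1 = 2 * x1 - 2 ∧ form K S2 = 2 * x2 - 2 ∧
    form K S3 = 2 * x3 - 2 ∧ form K S4 = 2 * x4 - 2 ∧ form K S5 = 2 * x5 - 2 ∧
    form K S6 = 2 * x6 - 2 ∧ form K S7 = 2 * x7 - 2 ∧
    form K S8 = 2 * (level p % 25 : ℕ) - 9 ∧ form K S9 = 2 * x9 - 3 := by
  intro p K
  simp only [form_eq, K, vec, core, p, R0, R1, R2, R3, S1, S2, S3, S4, S5, S6, S7, S8, S9]
  simp [level, levelAt]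
  omega

/-- The vectors `R₀, …, R₃, S₁, …, S₉`, which span a sublattice of index `25`. -/
def spanning : Fin 13 → L' := ![R0, R1, R2, R3, S1, S2, S3, S4, S5, S6, S7, S8, S9]

/-- `25` times the inverse of the matrix computing pairings with `spanning`. -/
def dual : Fin 13 → Fin 13 → ℤ :=
  ![![-29, -28, -27, -26, 67, -17, 87, 156, 9, 21, 18, -9, 104],
    ![-26, -32, -38, -19, 48, 2, 78, 114, 21, 24, 42, 4, 76],
    ![18, 26, 34, 17, -39, 14, -54, -102, -3, -7, -6, 3, -68],
    ![13, 16, 19, 22, -24, -1, -39, -57, -23, -12, -21, -2, -38],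
    ![13, 16, 19, 22, -24, -1, -39, -57, 2, -12, -21, -2, -38],
    ![11, 2, 18, 9, -28, 3, -33, -54, -6, -14, -12, 6, -36],
    ![12, 9, 6, 3, -26, 1, -36, -68, -2, -13, -4, 2, -37],
    ![12, 9, 6, 3, -26, 26, -36, -68, -2, -13, -4, 2, -37],
    ![11, 27, 18, 9, -28, 3, -33, -54, -6, -14, -12, 6, -36],
    ![12, 9, 6, 3, -26, 1, -36, -43, -2, -13, -4, 2, -37],
    ![12, 9, 6, 3, -26, 1, -11, -43, -2, -13, -4, 2, -37],
    ![8, 6, 4, 2, -9, -16, -24, -12, -18, 8, -36, -7, -8],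
    ![8, 6, 4, 2, 16, -16, -24, -12, -18, 8, -36, -7, -8]]

theorem dual_spanning (j k : Fin 13) :
    ∑ i, dual j i * form (Pi.single k 1) (spanning i) = if j = k then 25 else 0 := by
  revert j k
  decide +kernel

theorem form_eq_sum_single (K x : L') : form K x = ∑ k, K k * form (Pi.single k 1) x := by
  let f : L' →ₗ[ℤ] ℤ :=
    { toFun := fun y => form y x
      map_add' := fun y z => by simp only [form_eq, Pi.add_apply]; ring
      map_smul' := fun m y => by
        simp only [form_eq, Pi.smul_apply, smul_eq_mul, eq_intCast, Int.cast_eq]; ring }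
  refine (f.pi_apply_eq_sum_univ K).trans (Finset.sum_congr rfl fun k _ => ?_)
  have : (fun j => if k = j then (1 : ℤ) else 0) = Pi.single k 1 := by
    funext j
    simp [Pi.single_apply, eq_comm]
  rw [this]
  rfl

/-- The coordinates of a vector recovered from its pairings. -/
theorem coord_eq (K : L') (j : Fin 13) :
    25 * K j = ∑ i, dual j i * form K (spanning i) := by
  simp_rw [form_eq_sum_single K, Finset.mul_sum]
  rw [Finset.sum_comm]
  have (k : Fin 13) : ∑ i, dual j i * (K k * form (Pi.single k 1) (spanning i)) =
      K k * if j = k then 25 else 0 := by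
    rw [← dual_spanning j k, Finset.mul_sum]
    exact Finset.sum_congr rfl fun i _ => by ring
  simp [this, mul_comm]

theorem ext_of_pairings {K K' : L'} (h : ∀ i, form K (spanning i) = form K' (spanning i)) :
    K = K' := by
  funext j
  have h1 := coord_eq K j
  have h2 := coord_eq K' j
  simp_rw [h] at h1
  omega

/-- A vector is determined by its pairings. -/
theorem eq_vec_of_pairings {K : L'} {r0 r1 r2 r3 x1 x2 x3 x4 x5 x6 x7 b x9 : ℕ} (hb : b < 25)
    (h0 : form K R0 = 2 * r0 - 5) (h1 : form K R1 = 2 * r1 - 2) (h2 : form K R2 = 2 * r2 - 2)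
    (h3 : form K R3 = 2 * r3 - 2) (k1 : form K S1 = 2 * x1 - 2) (k2 : form K S2 = 2 * x2 - 2)
    (k3 : form K S3 = 2 * x3 - 2) (k4 : form K S4 = 2 * x4 - 2) (k5 : form K S5 = 2 * x5 - 2)
    (k6 : form K S6 = 2 * x6 - 2) (k7 : form K S7 = 2 * x7 - 2) (k8 : form K S8 = 2 * b - 9)
    (k9 : form K S9 = 2 * x9 - 3) :
    level ((r0, r1, r2, r3), x1, x2, x3, x4, x5, x6, x7, x9) % 25 = b ∧
      vec ((r0, r1, r2, r3), x1, x2, x3, x4, x5, x6, x7, x9) = K := by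
  have hlevel : level ((r0, r1, r2, r3), x1, x2, x3, x4, x5, x6, x7, x9) % 25 = b := by
    have h := coord_eq K 3
    simp [Fin.sum_univ_succ, dual, spanning] at h
    rw [h0, h1, h2, h3, k1, k2, k3, k4, k5, k6, k7, k8, k9] at h
    clear h0 h1 h2 h3 k1 k2 k3 k4 k5 k6 k7 k8 k9
    simp only [level, levelAt]
    omega
  refine ⟨hlevel, ext_of_pairings fun i => ?_⟩
  obtain ⟨h0', h1', h2', h3', k1', k2', k3', k4', k5', k6', k7', k8', k9'⟩ :=
    vec_pairings r0 r1 r2 r3 x1 x2 x3 x4 x5 x6 x7 x9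
  rw [hlevel] at k8'
  fin_cases i
  exacts [h0'.trans h0.symm, h1'.trans h1.symm, h2'.trans h2.symm, h3'.trans h3.symm,
    k1'.trans k1.symm, k2'.trans k2.symm, k3'.trans k3.symm, k4'.trans k4.symm,
    k5'.trans k5.symm, k6'.trans k6.symm, k7'.trans k7.symm, k8'.trans k8.symm,
    k9'.trans k9.symm]

theorem isCharacteristic_vec (p : Param) : IsCharacteristic (vec p) := by
  obtain ⟨⟨r0, r1, r2, r3⟩, x1, x2, x3, x4, x5, x6, x7, x9⟩ := p
  refine isCharacteristic_of_parity ?_ ?_ fun i hi => ?_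
  · simp [vec, core]
  · simp [vec, core]
  · fin_cases i <;> simp [vec, core] at hi ⊢

theorem vec_injective : Function.Injective vec := by
  rintro ⟨⟨r0, r1, r2, r3⟩, x1, x2, x3, x4, x5, x6, x7, x9⟩
    ⟨⟨r0', r1', r2', r3'⟩, x1', x2', x3', x4', x5', x6', x7', x9'⟩ h
  have h1 := vec_pairings r0 r1 r2 r3 x1 x2 x3 x4 x5 x6 x7 x9
  have h2 := vec_pairings r0' r1' r2' r3' x1' x2' x3' x4' x5' x6' x7' x9'
  dsimp only at h1 h2
  rw [h] at h1
  simp only [Prod.mk.injEq]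
  omega

/-- The norm of a vector given by half-coordinates. -/
theorem form_half_coords (a b e1 e2 e3 e4 e5 e6 e7 e8 e9 e10 e11 : ℤ) :
    let K : L' := ![2 * a, 2 * b, 2 * e1 + 1, 2 * e2 + 1, 2 * e3 + 1, 2 * e4 + 1, 2 * e5 + 1,
      2 * e6 + 1, 2 * e7 + 1, 2 * e8 + 1, 2 * e9 + 1, 2 * e10 + 1, 2 * e11 + 1]
    form K K = 4 * (2 * (a * b) - (e1 * (e1 + 1) + e2 * (e2 + 1) + e3 * (e3 + 1) + e4 * (e4 + 1) +
      e5 * (e5 + 1) + e6 * (e6 + 1) + e7 * (e7 + 1) + e8 * (e8 + 1) + e9 * (e9 + 1) +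
      e10 * (e10 + 1) + e11 * (e11 + 1))) - 11 := by
  intro K
  rw [form_eq]
  change 2 * a * (2 * b) + 2 * b * (2 * a) - ((2 * e1 + 1) * (2 * e1 + 1) +
    (2 * e2 + 1) * (2 * e2 + 1) + (2 * e3 + 1) * (2 * e3 + 1) + (2 * e4 + 1) * (2 * e4 + 1) +
    (2 * e5 + 1) * (2 * e5 + 1) + (2 * e6 + 1) * (2 * e6 + 1) + (2 * e7 + 1) * (2 * e7 + 1) +
    (2 * e8 + 1) * (2 * e8 + 1) + (2 * e9 + 1) * (2 * e9 + 1) + (2 * e10 + 1) * (2 * e10 + 1) +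
    (2 * e11 + 1) * (2 * e11 + 1)) = _
  ring

/-- The positive terms of `(⟨K,K⟩ + 3) / 4` for `K = vec p`, as a polynomial in the entries of `p`
and `q = level p / 25`. -/
def normPos (r0 r1 r2 r3 x1 x2 x3 x4 x5 x6 x7 x9 q : ℕ) : ℕ :=
  20 + q * (103 + 418 * r0 + 176 * r1 + 484 * r2 + 242 * r3 + 250 * x1 + 300 * x2 + 400 * x3 +
    150 * x4 + 50 * x5 + 400 * x6 + 100 * x7 + 100 * x9)

/-- The negative terms of `(⟨K,K⟩ + 3) / 4` for `K = vec p`, as a polynomial in the entries of `p`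
and `q = level p / 25`. -/
def normNeg (r0 r1 r2 r3 x1 x2 x3 x4 x5 x6 x7 x9 q : ℕ) : ℕ :=
  r0 * (77 + 159 * r0) +
    r1 * (29 + 134 * r0 + 29 * r1) +
    r2 * (86 + 368 * r0 + 156 * r1 + 214 * r2) +
    r3 * (42 + 184 * r0 + 78 * r1 + 214 * r2 + 54 * r3) +
    x1 * (55 + 190 * r0 + 80 * r1 + 220 * r2 + 110 * r3 + 57 * x1) +
    x2 * (55 + 228 * r0 + 96 * r1 + 264 * r2 + 132 * r3 + 136 * x1 + 83 * x2) +
    x3 * (87 + 304 * r0 + 128 * r1 + 352 * r2 + 176 * r3 + 180 * x1 + 218 * x2 + 145 * x3) +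
    x4 * (49 + 114 * r0 + 48 * r1 + 132 * r2 + 66 * r3 + 66 * x1 + 80 * x2 + 106 * x3 + 19 * x4)
      +
    x5 * (11 + 38 * r0 + 16 * r1 + 44 * r2 + 22 * r3 + 22 * x1 + 28 * x2 + 36 * x3 + 12 * x4 +
      3 * x5) +
    x6 * (78 + 304 * r0 + 128 * r1 + 352 * r2 + 176 * r3 + 182 * x1 + 218 * x2 + 290 * x3 +
      108 * x4 + 36 * x5 + 146 * x6) +
    x7 * (24 + 76 * r0 + 32 * r1 + 88 * r2 + 44 * r3 + 44 * x1 + 56 * x2 + 72 * x3 + 24 * x4 +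
      10 * x5 + 72 * x6 + 10 * x7) +
    x9 * (34 + 76 * r0 + 32 * r1 + 88 * r2 + 44 * r3 + 44 * x1 + 54 * x2 + 70 * x3 + 24 * x4 +
      8 * x5 + 72 * x6 + 16 * x7 + 8 * x9) +
    q * (275 * q)

theorem form_vec (r0 r1 r2 r3 x1 x2 x3 x4 x5 x6 x7 x9 : ℕ) :
    let p : Param := ((r0, r1, r2, r3), x1, x2, x3, x4, x5, x6, x7, x9)
    form (vec p) (vec p) = 4 * (normPos r0 r1 r2 r3 x1 x2 x3 x4 x5 x6 x7 x9 (level p / 25) -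
      normNeg r0 r1 r2 r3 x1 x2 x3 x4 x5 x6 x7 x9 (level p / 25)) - 3 := by
  intro p
  simp only [p, vec, core]
  rw [form_half_coords]
  generalize level ((r0, r1, r2, r3), x1, x2, x3, x4, x5, x6, x7, x9) / 25 = q
  simp only [normPos, normNeg]
  push_cast
  ring

theorem exists_nat_of_adjunction {m n : ℤ} {k : ℕ} (hk : n = -(k : ℤ)) (hm : |m| ≤ -n)
    (hp : m ≡ n [ZMOD 2]) : ∃ x : ℕ, x < k + 1 ∧ m = 2 * x - k := by
  rw [abs_le] at hm
  rw [Int.ModEq] at hp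
  exact ⟨((m + k) / 2).toNat, by omega, by omega⟩

theorem adjunction_of_nat {m n : ℤ} {k x : ℕ} (hk : n = -(k : ℤ)) (hx : x < k + 1)
    (hm : m = 2 * x - k) : |m| ≤ -n ∧ m ≡ n [ZMOD 2] := by
  rw [abs_le, Int.ModEq]
  omega

theorem toQ_mem_adjQ_iff (K : L') : toQ K ∈ AdjQ ↔
    ((form K R0, form K R1, form K R2, form K R3) ∈
      ({(5,0,0,0), (-1,-2,0,0), (3,0,0,-2), (-5,0,0,0), (1,0,-2,0)} : Set (ℤ × ℤ × ℤ × ℤ))) ∧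
    ∀ i : Fin 9, |form K (S i)| ≤ -form (S i) (S i) ∧
      form K (S i) ≡ form (S i) (S i) [ZMOD 2] := by
  simp only [AdjQ, Set.mem_ofPred_eq, formQ_toQ, Set.mem_insert_iff, Set.mem_singleton_iff,
    Prod.mk.injEq, Int.cast_inj, exists_eq_left']
  norm_cast

theorem charAdj_eq : CharAdj = (fun p => toQ (vec p)) '' (params : Set Param) := by
  have n1 : form S1 S1 = -(2 : ℕ) := by decide
  have n2 : form S2 S2 = -(2 : ℕ) := by decide
  have n3 : form S3 S3 = -(2 : ℕ) := by decide
  have n4 : form S4 S4 = -(2 : ℕ) := by decide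
  have n5 : form S5 S5 = -(2 : ℕ) := by decide
  have n6 : form S6 S6 = -(2 : ℕ) := by decide
  have n7 : form S7 S7 = -(2 : ℕ) := by decide
  have n8 : form S8 S8 = -(9 : ℕ) := by decide
  have n9 : form S9 S9 = -(3 : ℕ) := by decide
  ext K
  constructor
  · rintro ⟨hK, K, rfl, -⟩
    obtain ⟨hR, hS⟩ := (toQ_mem_adjQ_iff K).mp hK
    obtain ⟨x1, l1, k1⟩ := exists_nat_of_adjunction n1 (hS 0).1 (hS 0).2
    obtain ⟨x2, l2, k2⟩ := exists_nat_of_adjunction n2 (hS 1).1 (hS 1).2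
    obtain ⟨x3, l3, k3⟩ := exists_nat_of_adjunction n3 (hS 2).1 (hS 2).2
    obtain ⟨x4, l4, k4⟩ := exists_nat_of_adjunction n4 (hS 3).1 (hS 3).2
    obtain ⟨x5, l5, k5⟩ := exists_nat_of_adjunction n5 (hS 4).1 (hS 4).2
    obtain ⟨x6, l6, k6⟩ := exists_nat_of_adjunction n6 (hS 5).1 (hS 5).2
    obtain ⟨x7, l7, k7⟩ := exists_nat_of_adjunction n7 (hS 6).1 (hS 6).2
    obtain ⟨b, l8, k8⟩ := exists_nat_of_adjunction n8 (hS 7).1 (hS 7).2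
    obtain ⟨x9, l9, k9⟩ := exists_nat_of_adjunction n9 (hS 8).1 (hS 8).2
    obtain ⟨r0, r1, r2, r3, hr, h0, h1, h2, h3⟩ : ∃ r0 r1 r2 r3 : ℕ, (r0, r1, r2, r3) ∈ types ∧
        form K R0 = 2 * r0 - 5 ∧ form K R1 = 2 * r1 - 2 ∧ form K R2 = 2 * r2 - 2 ∧
        form K R3 = 2 * r3 - 2 := by
      simp only [Set.mem_insert_iff, Set.mem_singleton_iff, Prod.mk.injEq] at hR
      rcases hR with h | h | h | h | h
      · exact ⟨5, 1, 1, 1, by decide, by omega⟩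
      · exact ⟨2, 0, 1, 1, by decide, by omega⟩
      · exact ⟨4, 1, 1, 0, by decide, by omega⟩
      · exact ⟨0, 1, 1, 1, by decide, by omega⟩
      · exact ⟨3, 1, 0, 1, by decide, by omega⟩
    obtain ⟨hl, hv⟩ := eq_vec_of_pairings (by omega) h0 h1 h2 h3 k1 k2 k3 k4 k5 k6 k7 k8 k9
    refine ⟨((r0, r1, r2, r3), x1, x2, x3, x4, x5, x6, x7, x9), ?_, congrArg toQ hv⟩
    simp only [params, box, Finset.coe_filter, Set.mem_ofPred_eq, Finset.mem_product,
      Finset.mem_range, hl]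
    exact ⟨⟨hr, l1, l2, l3, l4, l5, l6, l7, l9⟩, l8⟩
  · rintro ⟨⟨⟨r0, r1, r2, r3⟩, x1, x2, x3, x4, x5, x6, x7, x9⟩, hp, rfl⟩
    refine ⟨(toQ_mem_adjQ_iff _).mpr ?_, _, rfl, isCharacteristic_vec _⟩
    simp only [params, box, Finset.coe_filter, Set.mem_ofPred_eq, Finset.mem_product,
      Finset.mem_range] at hp
    obtain ⟨⟨hr, l1, l2, l3, l4, l5, l6, l7, l9⟩, l8⟩ := hp
    obtain ⟨h0, h1, h2, h3, k1, k2, k3, k4, k5, k6, k7, k8, k9⟩ :=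
      vec_pairings r0 r1 r2 r3 x1 x2 x3 x4 x5 x6 x7 x9
    constructor
    · rw [h0, h1, h2, h3]
      simp only [types, Finset.mem_insert, Finset.mem_singleton, Prod.mk.injEq] at hr
      rcases hr with ⟨rfl, rfl, rfl, rfl⟩ | ⟨rfl, rfl, rfl, rfl⟩ | ⟨rfl, rfl, rfl, rfl⟩ |
        ⟨rfl, rfl, rfl, rfl⟩ | ⟨rfl, rfl, rfl, rfl⟩ <;> simp
    · intro i
      fin_cases i
      · exact adjunction_of_nat n1 l1 k1
      · exact adjunction_of_nat n2 l2 k2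
      · exact adjunction_of_nat n3 l3 k3
      · exact adjunction_of_nat n4 l4 k4
      · exact adjunction_of_nat n5 l5 k5
      · exact adjunction_of_nat n6 l6 k6
      · exact adjunction_of_nat n7 l7 k7
      · exact adjunction_of_nat n8 l8 k8
      · exact adjunction_of_nat n9 l9 k9

theorem sep_charAdj_eq : {K ∈ CharAdj | formQ K K ≥ -3} = (fun p => toQ (vec p)) ''
    ((params.filter fun p => -3 ≤ form (vec p) (vec p) : Finset Param) : Set Param) := by
  have key (p : Param) : formQ (toQ (vec p)) (toQ (vec p)) ≥ -3 ↔ -3 ≤ form (vec p) (vec p) := by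
    rw [formQ_toQ]
    norm_cast
  rw [charAdj_eq]
  ext K
  simp only [Set.mem_ofPred_eq, Set.mem_image, Finset.coe_filter, Finset.mem_coe]
  constructor
  · rintro ⟨⟨p, hp, rfl⟩, h⟩
    exact ⟨p, ⟨hp, (key p).mp h⟩, rfl⟩
  · rintro ⟨p, ⟨hp, h⟩, rfl⟩
    exact ⟨⟨p, hp, rfl⟩, (key p).mpr h⟩

/-- `f 0 + ⋯ + f (n-1)`, in a form that the kernel evaluates quickly. -/
def sumTo (n : ℕ) (f : ℕ → ℕ) : ℕ := Nat.rec 0 (fun k s => Nat.add s (f k)) n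

theorem sum_range_eq_sumTo (n : ℕ) (f : ℕ → ℕ) : ∑ i ∈ Finset.range n, f i = sumTo n f := by
  induction n with
  | zero => rfl
  | succ n ih => rw [Finset.sum_range_succ, ih]; rfl

theorem sum_box (F : Param → ℕ) : ∑ p ∈ box, F p =
    ∑ r ∈ types, sumTo 3 fun x1 => sumTo 3 fun x2 => sumTo 3 fun x3 => sumTo 3 fun x4 =>
      sumTo 3 fun x5 => sumTo 3 fun x6 => sumTo 3 fun x7 => sumTo 4 fun x9 =>
        F ((r.1, r.2.1, r.2.2.1, r.2.2.2), x1, x2, x3, x4, x5, x6, x7, x9) := by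
  simp only [box, Finset.sum_product, sum_range_eq_sumTo]

theorem ite_eq_cond_ble (a b m n : ℕ) : (if a ≤ b then m else n) = cond (Nat.ble a b) m n := by
  by_cases h : a ≤ b
  · rw [if_pos h, Nat.ble_eq_true_of_le h, cond_true]
  · rw [if_neg h, Bool.eq_false_iff.mpr (mt Nat.le_of_ble_eq_true h), cond_false]

theorem card_params : params.card = 17496 := by
  have h (p : Param) : (if level p % 25 < 10 then 1 else 0) =
      cond (Nat.ble (level p % 25) 9) 1 0 := by
    rw [← ite_eq_cond_ble]
    exact if_congr Nat.lt_succ_iff rfl rfl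
  rw [params, Finset.card_filter, Finset.sum_congr rfl fun p _ => h p, sum_box]
  simp only [level]
  decide +kernel

theorem card_params_filter : (params.filter fun p => -3 ≤ form (vec p) (vec p)).card = 3754 := by
  have h (r0 r1 r2 r3 x1 x2 x3 x4 x5 x6 x7 x9 : ℕ) :
      let p : Param := ((r0, r1, r2, r3), x1, x2, x3, x4, x5, x6, x7, x9)
      (if level p % 25 < 10 ∧ -3 ≤ form (vec p) (vec p) then 1 else 0) =
        cond (Nat.ble (level p % 25) 9)
          (cond (Nat.ble (normNeg r0 r1 r2 r3 x1 x2 x3 x4 x5 x6 x7 x9 (level p / 25))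
            (normPos r0 r1 r2 r3 x1 x2 x3 x4 x5 x6 x7 x9 (level p / 25))) 1 0) 0 := by
    dsimp only
    rw [← ite_eq_cond_ble, ← ite_eq_cond_ble, form_vec, ite_and]
    exact if_congr Nat.lt_succ_iff (if_congr (by omega) rfl rfl) rfl
  rw [params, Finset.filter_filter, Finset.card_filter, sum_box]
  simp only [h]
  simp only [level]
  decide +kernel

/-- exactly `17496` of the adjunctive vectors are integral characteristic
vectors, and of those exactly `3754` satisfy `⟨K,K⟩ ≥ −3`. -/
theorem characteristic_adjunctive_count :
    CharAdj.Finite ∧ CharAdj.ncard = 17496 ∧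
    {K ∈ CharAdj | formQ K K ≥ -3}.ncard = 3754 := by
  have hinj : Function.Injective fun p => toQ (vec p) := toQ_injective.comp vec_injective
  refine ⟨?_, ?_, ?_⟩
  · rw [charAdj_eq]
    exact params.finite_toSet.image _
  · rw [charAdj_eq, Set.ncard_image_of_injective _ hinj, Set.ncard_coe_finset, card_params]
  · rw [sep_charAdj_eq, Set.ncard_image_of_injective _ hinj, Set.ncard_coe_finset,
      card_params_filter]

end ParkQ
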